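/- Let (N,R) be an STP instance with N=(V,E,σ), and let u∈V∖R be a non-terminal vertex with degree at least 3. Suppose that for every subset A of the edges incident to u with |A|≥3, the total cost Σ_{e∈A} σ(e) is at least the cost of a minimum spanning tree of the Steiner distance network D'(S_A), where S_A = {v : {u,v}∈A} is the set of other endpoints of the edges in A. Then there exists an SMT of (N,R) in which the vertex u has degree at most 2. -/

import Mathlib

open SimpleGraph

variable {V : Type*}

/-- The cost of a walk: the sum of the costs of its edges. -/
def walkCost {G : SimpleGraph V} (σ : Sym2 V → ℕ) {u v : V} (w : G.Walk u v) : ℕ :=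
  (w.edges.map σ).sum

/-- The shortest-path distance `d_N(u,v)` in the network `(G, σ)`. -/
noncomputable def netDist (G : SimpleGraph V) (σ : Sym2 V → ℕ) (u v : V) : ℕ :=
  sInf {c | ∃ w : G.Walk u v, walkCost σ w = c}

/-- Shortest-path distance as a function on unordered pairs. -/
noncomputable def sym2Dist (G : SimpleGraph V) (σ : Sym2 V → ℕ) (e : Sym2 V) : ℕ :=
  sInf {c | ∃ x y : V, e = s(x, y) ∧ ∃ w : G.Walk x y, walkCost σ w = c}

/-- The cost of a subgraph: the sum of the costs of its edges. -/
noncomputable def subCost [Fintype V] {G : SimpleGraph V} (σ : Sym2 V → ℕ)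
    (H : G.Subgraph) : ℕ :=
  ∑ e ∈ H.edgeSet.toFinite.toFinset, σ e

/-- A Steiner tree for terminals `R`: a subtree of `G` whose vertex set contains `R`. -/
def IsSteinerTree {G : SimpleGraph V} (R : Set V) (H : G.Subgraph) : Prop :=
  H.coe.IsTree ∧ R ⊆ H.verts

/-- The minimum cost of a Steiner tree for `(G, σ, R)`. -/
noncomputable def csmt [Fintype V] (G : SimpleGraph V) (σ : Sym2 V → ℕ) (R : Set V) : ℕ :=
  sInf {c | ∃ H : G.Subgraph, IsSteinerTree R H ∧ subCost σ H = c}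

/-- A Steiner minimal tree (SMT). -/
def IsSMT [Fintype V] (G : SimpleGraph V) (σ : Sym2 V → ℕ) (R : Set V)
    (H : G.Subgraph) : Prop :=
  IsSteinerTree R H ∧ subCost σ H = csmt G σ R

/-- The sub-SMT cost `l*(u, I) = csmt(N, I ∪ {u})`. -/
noncomputable def lstar [Fintype V] (G : SimpleGraph V) (σ : Sym2 V → ℕ)
    (u : V) (I : Set V) : ℕ :=
  csmt G σ (I ∪ {u})

/-- The cost of a minimum spanning tree of the complete network on `S`
with edge weights `w` (as a function on unordered pairs of `V`). -/
noncomputable def mstCost [Fintype V] (w : Sym2 V → ℕ) (S : Set V) : ℕ :=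
  sInf {c | ∃ T : SimpleGraph ↥S, T.IsTree ∧
    c = ∑ e ∈ T.edgeSet.toFinite.toFinset, w (e.map (Subtype.val : ↥S → V))}

-- Auxiliary fold computing the Steiner distance of a walk: the pair of
-- (the maximum cost among the already completed elementary segments,
-- the cost of the initial elementary segment), where the walk is split at
-- every visited terminal of `R`.
open Classical in
noncomputable def segMax {G : SimpleGraph V} (σ : Sym2 V → ℕ) (R : Set V) :
    {a b : V} → G.Walk a b → ℕ × ℕ
  | _, _, SimpleGraph.Walk.nil => (0, 0)
  | _, _, @SimpleGraph.Walk.cons _ _ a c _ _ w =>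
      let p := segMax σ R w
      if c ∈ R then (max p.1 p.2, σ s(a, c)) else (p.1, σ s(a, c) + p.2)

/-- The Steiner distance of a walk with respect to terminals `R`:
the maximum cost among its elementary subpaths (obtained by splitting the
walk at the intermediate terminals). -/
noncomputable def walkSD {G : SimpleGraph V} (σ : Sym2 V → ℕ) (R : Set V)
    {a b : V} (w : G.Walk a b) : ℕ :=
  max (segMax σ R w).1 (segMax σ R w).2

/-- The restricted bottleneck Steiner distance `s̄(u,v)`: the minimum Steiner
distance among all paths connecting `u` and `v` that avoid the edge `{u,v}`. -/
noncomputable def restrictedBottleneck (G : SimpleGraph V) (σ : Sym2 V → ℕ)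
    (R : Set V) (u v : V) : ℕ :=
  sInf {c | ∃ w : G.Walk u v, w.IsPath ∧ s(u, v) ∉ w.edges ∧ walkSD σ R w = c}

/-- The bottleneck Steiner distance as a function on unordered pairs. -/
noncomputable def sym2Bottleneck (G : SimpleGraph V) (σ : Sym2 V → ℕ) (R : Set V)
    (e : Sym2 V) : ℕ :=
  sInf {c | ∃ x y : V, e = s(x, y) ∧ ∃ w : G.Walk x y, w.IsPath ∧ walkSD σ R w = c}

/-- The graph whose edges are those of `F` and those listed in `L`. -/
def joinGraph (F : Finset (Sym2 V)) (L : List (Sym2 V)) : SimpleGraph V :=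
  fromEdgeSet {e | e ∈ F ∨ e ∈ L}

theorem joinGraph_mono {F F' : Finset (Sym2 V)} {L L' : List (Sym2 V)}
    (h : ∀ e, e ∈ F ∨ e ∈ L → e ∈ F' ∨ e ∈ L') : joinGraph F L ≤ joinGraph F' L' :=
  fromEdgeSet_mono h

/-- Any two vertices of `D` are joined by a walk of `K`. -/
def Links (K : SimpleGraph V) (D : Set V) : Prop :=
  ∀ x ∈ D, ∀ y ∈ D, K.Reachable x y

theorem walkCost_append {G : SimpleGraph V} (σ : Sym2 V → ℕ) {a b c : V}
    (p : G.Walk a b) (q : G.Walk b c) :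
    walkCost σ (p.append q) = walkCost σ p + walkCost σ q := by
  simp [walkCost, Walk.edges_append]

theorem walkCost_cons {G : SimpleGraph V} (σ : Sym2 V → ℕ) {a b c : V}
    (h : G.Adj a b) (q : G.Walk b c) :
    walkCost σ (Walk.cons h q) = σ s(a, b) + walkCost σ q := by
  simp [walkCost]

theorem walkCost_pos {G : SimpleGraph V} {σ : Sym2 V → ℕ}
    (hpos : ∀ e ∈ G.edgeSet, 0 < σ e) {a b : V} (hab : a ≠ b) (p : G.Walk a b) :
    0 < walkCost σ p := by
  cases p with
  | nil => exact absurd rfl hab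
  | cons h q =>
    rw [walkCost_cons]
    have := hpos _ (G.mem_edgeSet.2 h)
    omega

theorem sum_edges_le_walkCost [DecidableEq V] {G : SimpleGraph V} (σ : Sym2 V → ℕ) {a b : V}
    (p : G.Walk a b) : ∑ e ∈ p.edges.toFinset, σ e ≤ walkCost σ p := by
  induction p with
  | nil => simp [walkCost]
  | @cons x y _ h q ih =>
    rw [walkCost_cons, Walk.edges_cons, List.toFinset_cons]
    by_cases hm : s(x, y) ∈ q.edges.toFinset
    · rw [Finset.insert_eq_of_mem hm]; omega
    · rw [Finset.sum_insert hm]; omega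

/-- The initial elementary segment of a walk can be split off. -/
theorem exists_initial_segment {G : SimpleGraph V} (σ : Sym2 V → ℕ) (R : Set V) {a b : V}
    (w : G.Walk a b) :
    ∃ (t : V) (q : G.Walk a t) (r : G.Walk t b), w = q.append r ∧
      walkCost σ q ≤ (segMax σ R w).2 ∧ (t = b ∨ t ∈ R) ∧
      walkSD σ R r ≤ (segMax σ R w).1 ∧ (a ≠ b → r.length < w.length) := by
  suffices H : ∃ (t : V) (q : G.Walk a t) (r : G.Walk t b), w = q.append r ∧
      walkCost σ q ≤ (segMax σ R w).2 ∧ (t = b ∨ t ∈ R) ∧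
      walkSD σ R r ≤ (segMax σ R w).1 ∧ (w.length = 0 ∨ r.length < w.length) by
    obtain ⟨t, q, r, h1, h2, h3, h4, h5⟩ := H
    refine ⟨t, q, r, h1, h2, h3, h4, fun hab => h5.resolve_left fun h0 => ?_⟩
    exact hab (Walk.eq_of_length_eq_zero h0)
  induction w with
  | nil => exact ⟨_, Walk.nil, Walk.nil, by simp, by simp [walkCost], Or.inl rfl,
      by simp [walkSD, segMax], Or.inl rfl⟩
  | @cons a c b h w ih =>
    by_cases hc : c ∈ R
    · refine ⟨c, Walk.cons h Walk.nil, w, by simp, ?_, Or.inr hc, ?_, Or.inr (by simp)⟩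
      · simp [segMax, hc, walkCost]
      · simp [segMax, hc, walkSD]
    · obtain ⟨t, q, r, h1, h2, h3, h4, h5⟩ := ih
      refine ⟨t, Walk.cons h q, r, by simp [h1], ?_, h3, ?_, Or.inr ?_⟩
      · simpa [segMax, hc, walkCost_cons] using h2
      · simpa [segMax, hc] using h4
      · rw [h1]; simp

/-- A path leaving a set contains a piece of cost at most its Steiner distance that leaves the
set and whose endpoints are terminals or endpoints of the path. -/
theorem exists_crossing_segment {G : SimpleGraph V} (σ : Sym2 V → ℕ) (R : Set V) (C : Set V)
    {a b : V} (w : G.Walk a b) (hw : w.IsPath) (ha : a ∈ C) (hb : b ∉ C) :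
    ∃ (t t' : V) (q : G.Walk t t'), q.IsPath ∧ walkCost σ q ≤ walkSD σ R w ∧
      t ∈ C ∧ t' ∉ C ∧ (t = a ∨ t ∈ R) ∧ (t' = b ∨ t' ∈ R) := by
  induction hn : w.length using Nat.strong_induction_on generalizing a with
  | _ n ih =>
    obtain ⟨t, q, r, h1, h2, h3, h4, h5⟩ := exists_initial_segment σ R w
    have hab : a ≠ b := fun h => hb (h ▸ ha)
    have hqr : (q.append r).IsPath := h1 ▸ hw
    by_cases ht : t ∈ C
    · obtain ⟨x, y, p, p1, p2, p3, p4, p5, p6⟩ :=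
        ih _ (hn ▸ h5 hab) r hqr.of_append_right ht rfl
      have htR : t ∈ R := h3.resolve_left fun h => hb (h ▸ ht)
      refine ⟨x, y, p, p1, p2.trans (h4.trans (le_max_left _ _)), p3, p4, Or.inr ?_, p6⟩
      exact p5.elim (fun h => h ▸ htR) id
    · exact ⟨a, t, q, hqr.of_append_left, h2.trans (le_max_right _ _), ha, ht, Or.inl rfl, h3⟩

theorem exists_path_walkSD_eq {G : SimpleGraph V} (hconn : G.Connected) (σ : Sym2 V → ℕ)
    (R : Set V) (e : Sym2 V) :
    ∃ a b : V, e = s(a, b) ∧ ∃ w : G.Walk a b, w.IsPath ∧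
      walkSD σ R w = sym2Bottleneck G σ R e := by
  refine Nat.sInf_mem (s := {c | ∃ x y : V, e = s(x, y) ∧ ∃ w : G.Walk x y, w.IsPath ∧
    walkSD σ R w = c}) ?_
  induction e using Sym2.ind with
  | _ a b =>
    obtain ⟨p, hp⟩ := (hconn a b).exists_isPath
    exact ⟨_, a, b, rfl, p, hp, rfl⟩

theorem reachable_of_edges {G K : SimpleGraph V} {a b : V} (q : G.Walk a b)
    (h : ∀ e ∈ q.edges, e ∈ K.edgeSet) {x : V} (hx : x ∈ q.support) : K.Reachable a x := by
  classical
  refine ⟨(q.takeUntil x hx).transfer K fun e he => h e ?_⟩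
  exact Walk.edges_takeUntil_subset_edges _ _ he

theorem links_of_two_sides {G K K' : SimpleGraph V} {D : Set V} {a b t t' : V} (hK : K ≤ K')
    (hD : ∀ d ∈ D, K.Reachable a d ∨ K.Reachable b d) (ht : K.Reachable a t)
    (ht' : K.Reachable b t') (q : G.Walk t t') (hq : ∀ e ∈ q.edges, e ∈ K'.edgeSet) :
    Links K' (D ∪ {x | x ∈ q.support}) := by
  have key : ∀ x ∈ D ∪ {x | x ∈ q.support}, K'.Reachable t x := by
    rintro x (hx | hx)
    · rcases hD x hx with h | h
      · exact (ht.symm.trans h).mono hK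
      · exact (reachable_of_edges q hq q.end_mem_support).trans ((ht'.symm.trans h).mono hK)
    · exact reachable_of_edges q hq hx
  exact fun x hx y hy => (key x hx).symm.trans (key y hy)

/-- Deleting the edge `s(a, b)` either keeps `x` and `y` connected or leaves `y` connected
to `a` or to `b`. -/
theorem two_sides_of_links_cons {F : Finset (Sym2 V)} {L : List (Sym2 V)} {a b : V} {x y : V}
    (h : (joinGraph F (s(a, b) :: L)).Reachable x y) :
    (joinGraph F L).Reachable x y ∨
      ((joinGraph F L).Reachable a y ∨ (joinGraph F L).Reachable b y) := by
  obtain ⟨p⟩ := h.symm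
  induction p with
  | nil => exact Or.inl (Reachable.refl _)
  | @cons y z x hyz p ih =>
    by_cases he : s(y, z) = s(a, b)
    · right
      rcases Sym2.eq_iff.1 he with ⟨rfl, rfl⟩ | ⟨rfl, rfl⟩
      · exact Or.inl (Reachable.refl _)
      · exact Or.inr (Reachable.refl _)
    · have hzy : (joinGraph F L).Reachable z y := by
        refine (Adj.reachable ?_).symm
        simp only [joinGraph, fromEdgeSet_adj, Set.mem_ofPred_eq, List.mem_cons] at hyz ⊢
        tauto
      rcases ih ⟨p.reverse⟩ with h | h | h
      · exact Or.inl (h.trans hzy)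
      · exact Or.inr (Or.inl (h.trans hzy))
      · exact Or.inr (Or.inr (h.trans hzy))

theorem exists_reconnection {G : SimpleGraph V} (hconn : G.Connected) (σ : Sym2 V → ℕ)
    {R D : Set V} (hRD : R ⊆ D) {F : Finset (Sym2 V)} {L : List (Sym2 V)} {e : Sym2 V}
    (h : Links (joinGraph F (e :: L)) D) :
    Links (joinGraph F L) D ∨ ∃ (a b t t' : V) (q : G.Walk t t'), q.IsPath ∧
      walkCost σ q ≤ sym2Bottleneck G σ R e ∧
      (∀ d ∈ D, (joinGraph F L).Reachable a d ∨ (joinGraph F L).Reachable b d) ∧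
      (joinGraph F L).Reachable a t ∧ (joinGraph F L).Reachable b t' ∧
      (t ∈ e ∨ t ∈ R) ∧ (t' ∈ e ∨ t' ∈ R) := by
  refine or_iff_not_imp_left.2 fun hL => ?_
  obtain ⟨a, b, rfl, w, hw, hcost⟩ := exists_path_walkSD_eq hconn σ R e
  have hD : ∀ d ∈ D, (joinGraph F L).Reachable a d ∨ (joinGraph F L).Reachable b d := by
    intro d hd
    by_contra hcon
    refine hL fun x hx y hy => ?_
    have hx' := (two_sides_of_links_cons (h x hx d hd)).resolve_right hcon
    have hy' := (two_sides_of_links_cons (h y hy d hd)).resolve_right hcon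
    exact hx'.trans hy'.symm
  have hab : ¬ (joinGraph F L).Reachable a b := by
    intro hab
    have key : ∀ d ∈ D, (joinGraph F L).Reachable a d := fun d hd =>
      (hD d hd).elim id fun hb => hab.trans hb
    exact hL fun x hx y hy => (key x hx).symm.trans (key y hy)
  obtain ⟨t, t', q, hq, hqc, ht, ht', hta, htb⟩ := exists_crossing_segment σ R
    {x | (joinGraph F L).Reachable a x} w hw (Reachable.refl a) hab
  refine ⟨a, b, t, t', q, hq, hcost ▸ hqc, hD, ht, ?_, ?_, ?_⟩
  · rcases htb with rfl | htR
    · exact Reachable.refl _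
    · exact (hD t' (hRD htR)).resolve_left ht'
  · exact hta.imp_left fun h => by simp [h]
  · exact htb.imp_left fun h => by simp [h]

theorem exists_shorter_pieces {G : SimpleGraph V} {σ : Sym2 V → ℕ}
    (hpos : ∀ e ∈ G.edgeSet, 0 < σ e) {t t' u : V} (q : G.Walk t t') (hu : u ∈ q.support)
    (h : t ≠ u) (h' : u ≠ t') :
    (∃ p : G.Walk t u, walkCost σ p < walkCost σ q) ∧
      ∃ p : G.Walk u t', walkCost σ p < walkCost σ q := by
  classical
  have hs : walkCost σ (q.takeUntil u hu) + walkCost σ (q.dropUntil u hu) = walkCost σ q := by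
    rw [← walkCost_append, Walk.take_spec]
  have h1 := walkCost_pos hpos h (q.takeUntil u hu)
  have h2 := walkCost_pos hpos h' (q.dropUntil u hu)
  exact ⟨⟨q.takeUntil u hu, by omega⟩, ⟨q.dropUntil u hu, by omega⟩⟩

/-- Adding the edges of a walk of `G` to a set of edges of `G`. -/
theorem exists_add_walk {G : SimpleGraph V} (σ : Sym2 V → ℕ) {F : Finset (Sym2 V)}
    (hF : ↑F ⊆ G.edgeSet) (L : List (Sym2 V)) {D : Set V} {a b t t' : V}
    (hD : ∀ d ∈ D, (joinGraph F L).Reachable a d ∨ (joinGraph F L).Reachable b d)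
    (ht : (joinGraph F L).Reachable a t) (ht' : (joinGraph F L).Reachable b t')
    (q : G.Walk t t') :
    ∃ F' : Finset (Sym2 V), ↑F' ⊆ G.edgeSet ∧
      Links (joinGraph F' L) (D ∪ {x | x ∈ q.support}) ∧
      ∑ e ∈ F', σ e ≤ ∑ e ∈ F, σ e + walkCost σ q ∧
      ∀ e, e ∈ F' ↔ e ∈ F ∨ e ∈ q.edges := by
  classical
  refine ⟨F ∪ q.edges.toFinset, ?_, ?_, ?_, by simp⟩
  · intro e he
    simp only [Finset.coe_union, List.coe_toFinset, Set.mem_union, Set.mem_ofPred_eq,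
      Finset.mem_coe] at he
    exact he.elim (fun h => hF h) fun h => q.edges_subset_edgeSet h
  · refine links_of_two_sides (joinGraph_mono fun e he => ?_) hD ht ht' q fun e he => ?_
    · simp only [Finset.mem_union]; tauto
    · have := G.not_isDiag_of_mem_edgeSet (q.edges_subset_edgeSet he)
      simp [joinGraph, he, this]
  · have h1 := Finset.sum_union_inter (s₁ := F) (s₂ := q.edges.toFinset) (f := σ)
    have h2 := sum_edges_le_walkCost σ q
    omega

theorem exists_linking_of_mem {G : SimpleGraph V} {σ : Sym2 V → ℕ} (hconn : G.Connected)
    (hpos : ∀ e ∈ G.edgeSet, 0 < σ e) {R : Set V} {u : V} (hu : u ∉ R) (L : List (Sym2 V))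
    (hL : ∀ e ∈ L, u ∉ e) (F : Finset (Sym2 V)) (hF : ↑F ⊆ G.edgeSet)
    (h : Links (joinGraph F L) (insert u R)) :
    ∃ F' : Finset (Sym2 V), ↑F' ⊆ G.edgeSet ∧ Links (joinGraph F' []) R ∧
      ∑ e ∈ F', σ e ≤ ∑ e ∈ F, σ e + (L.map (sym2Bottleneck G σ R)).sum ∧
      ((∀ v, s(u, v) ∈ F' → s(u, v) ∈ F) ∨
        ∑ e ∈ F', σ e < ∑ e ∈ F, σ e + (L.map (sym2Bottleneck G σ R)).sum) := by
  induction L generalizing F with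
  | nil =>
    exact ⟨F, hF, fun x hx y hy => h x (Or.inr hx) y (Or.inr hy), by simp, Or.inl fun _ h => h⟩
  | cons e L ih =>
    have hL' : ∀ e ∈ L, u ∉ e := fun e he => hL e (List.mem_cons_of_mem _ he)
    have heu : u ∉ e := hL e List.mem_cons_self
    rw [List.map_cons, List.sum_cons]
    rcases exists_reconnection hconn σ (Set.subset_insert u R) h with
      hlink | ⟨a, b, t, t', q, -, hqc, hD, hat, hbt, hte, hte'⟩
    · obtain ⟨F', h1, h2, h3, h4⟩ := ih hL' F hF hlink
      exact ⟨F', h1, h2, by omega, h4.imp_right fun h => by omega⟩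
    · by_cases huq : u ∈ q.support
      · have htu : t ≠ u := by rintro rfl; tauto
        have htu' : u ≠ t' := by rintro rfl; tauto
        obtain ⟨⟨p, hp⟩, ⟨p', hp'⟩⟩ := exists_shorter_pieces hpos q huq htu htu'
        suffices H : ∃ F₁ : Finset (Sym2 V), ↑F₁ ⊆ G.edgeSet ∧
            Links (joinGraph F₁ L) (insert u R) ∧
            ∑ e ∈ F₁, σ e < ∑ e ∈ F, σ e + sym2Bottleneck G σ R e by
          obtain ⟨F₁, h1, h2, h3⟩ := H
          obtain ⟨F', k1, k2, k3, -⟩ := ih hL' F₁ h1 h2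
          exact ⟨F', k1, k2, by omega, Or.inr (by omega)⟩
        rcases hD u (Set.mem_insert u R) with hau | hbu
        · obtain ⟨F₁, h1, h2, h3, -⟩ := exists_add_walk σ hF L hD hau hbt p'
          exact ⟨F₁, h1, fun x hx y hy => h2 x (Or.inl hx) y (Or.inl hy), by omega⟩
        · obtain ⟨F₁, h1, h2, h3, -⟩ := exists_add_walk σ hF L hD hat hbu p
          exact ⟨F₁, h1, fun x hx y hy => h2 x (Or.inl hx) y (Or.inl hy), by omega⟩
      · obtain ⟨F₁, h1, h2, h3, h4⟩ := exists_add_walk σ hF L hD hat hbt q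
        obtain ⟨F', k1, k2, k3, k4⟩ :=
          ih hL' F₁ h1 fun x hx y hy => h2 x (Or.inl hx) y (Or.inl hy)
        refine ⟨F', k1, k2, by omega, k4.imp (fun k v hv => ?_) fun k => by omega⟩
        exact ((h4 _).1 (k v hv)).resolve_right fun hq =>
          huq (Walk.fst_mem_support_of_mem_edges _ hq)

theorem ncard_path_edges_eq_two {G : SimpleGraph V} {t t' u : V} {q : G.Walk t t'}
    (hq : q.IsPath) (hu : u ∈ q.support) (h : t ≠ u) (h' : u ≠ t') :
    {v | s(u, v) ∈ q.edges}.ncard = 2 := by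
  obtain ⟨i, rfl, hi⟩ := Walk.mem_support_iff_exists_getVert.1 hu
  have h0 : i ≠ 0 := by rintro rfl; simp at h
  have h1 : i ≠ q.length := by rintro rfl; simp at h'
  rw [← hq.ncard_neighborSet_toSubgraph_internal_eq_two h0 (lt_of_le_of_ne hi h1)]
  congr 1
  ext v
  simp [Walk.adj_toSubgraph_iff_mem_edges]

theorem exists_linking {G : SimpleGraph V} {σ : Sym2 V → ℕ} (hconn : G.Connected)
    (hpos : ∀ e ∈ G.edgeSet, 0 < σ e) {R : Set V} {u : V} (hu : u ∉ R) (L : List (Sym2 V))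
    (hL : ∀ e ∈ L, u ∉ e) (F : Finset (Sym2 V)) (hF : ↑F ⊆ G.edgeSet)
    (huF : ∀ v, s(u, v) ∉ F) (h : Links (joinGraph F L) R) :
    ∃ F' : Finset (Sym2 V), ↑F' ⊆ G.edgeSet ∧ Links (joinGraph F' []) R ∧
      ∑ e ∈ F', σ e ≤ ∑ e ∈ F, σ e + (L.map (sym2Bottleneck G σ R)).sum ∧
      ({v | s(u, v) ∈ F'}.ncard ≤ 2 ∨
        ∑ e ∈ F', σ e < ∑ e ∈ F, σ e + (L.map (sym2Bottleneck G σ R)).sum) := by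
  induction L generalizing F with
  | nil => exact ⟨F, hF, h, by simp, Or.inl (by simp [huF])⟩
  | cons e L ih =>
    have hL' : ∀ e ∈ L, u ∉ e := fun e he => hL e (List.mem_cons_of_mem _ he)
    have heu : u ∉ e := hL e List.mem_cons_self
    rw [List.map_cons, List.sum_cons]
    rcases exists_reconnection hconn σ subset_rfl h with
      hlink | ⟨a, b, t, t', q, hq, hqc, hD, hat, hbt, hte, hte'⟩
    · obtain ⟨F', h1, h2, h3, h4⟩ := ih hL' F hF huF hlink
      exact ⟨F', h1, h2, by omega, h4.imp_right fun h => by omega⟩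
    · obtain ⟨F₁, h1, h2, h3, h4⟩ := exists_add_walk σ hF L hD hat hbt q
      by_cases huq : u ∈ q.support
      · have htu : t ≠ u := by rintro rfl; tauto
        have htu' : u ≠ t' := by rintro rfl; tauto
        have hsub : insert u R ⊆ R ∪ {x | x ∈ q.support} :=
          Set.insert_subset (Or.inr huq) Set.subset_union_left
        obtain ⟨F', k1, k2, k3, k4⟩ := exists_linking_of_mem hconn hpos hu L hL' F₁ h1
          fun x hx y hy => h2 x (hsub hx) y (hsub hy)
        refine ⟨F', k1, k2, by omega, k4.imp (fun k => ?_) fun k => by omega⟩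
        have hcard := ncard_path_edges_eq_two hq huq htu htu'
        rw [← hcard]
        refine Set.ncard_le_ncard (fun v hv => ?_) (Set.finite_of_ncard_ne_zero (by omega))
        exact ((h4 _).1 (k v hv)).resolve_left (huF v)
      · have huF₁ : ∀ v, s(u, v) ∉ F₁ := fun v hv => ((h4 _).1 hv).elim (huF v) fun hq =>
          huq (Walk.fst_mem_support_of_mem_edges _ hq)
        obtain ⟨F', k1, k2, k3, k4⟩ :=
          ih hL' F₁ h1 huF₁ fun x hx y hy => h2 x (Or.inl hx) y (Or.inl hy)
        exact ⟨F', k1, k2, by omega, k4.imp_right fun k => by omega⟩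

theorem exists_steinerTree {G : SimpleGraph V} {R : Set V} (hR : R.Nonempty)
    {F : Finset (Sym2 V)} (hF : ↑F ⊆ G.edgeSet) (h : Links (joinGraph F []) R) :
    ∃ H : G.Subgraph, IsSteinerTree R H ∧ ∀ e ∈ H.edgeSet, e ∈ F := by
  obtain ⟨r, hr⟩ := hR
  let C := (joinGraph F []).connectedComponentMk r
  obtain ⟨T, hTC, hT⟩ := C.connected_toSimpleGraph.exists_isTree_le
  have hTF : ∀ {x y : C}, T.Adj x y → s(x.1, y.1) ∈ F := by
    intro x y hxy
    have hadj : (joinGraph F []).Adj x.1 y.1 := hTC hxy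
    simpa [joinGraph] using hadj.1
  let H : G.Subgraph :=
    { verts := C.supp
      Adj := fun x y => ∃ (hx : x ∈ C.supp) (hy : y ∈ C.supp), T.Adj ⟨x, hx⟩ ⟨y, hy⟩
      adj_sub := fun ⟨_, _, hxy⟩ => G.mem_edgeSet.1 (hF (hTF hxy))
      edge_vert := fun ⟨hx, _, _⟩ => hx
      symm := ⟨fun _ _ ⟨hx, hy, hxy⟩ => ⟨hy, hx, hxy.symm⟩⟩ }
  have hHT : (H.coe : SimpleGraph C) = T := by
    ext x y
    exact ⟨fun ⟨_, _, hxy⟩ => hxy, fun hxy => ⟨x.2, y.2, hxy⟩⟩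
  refine ⟨H, ⟨?_, ?_⟩, ?_⟩
  · exact hHT ▸ hT
  · exact fun x hx => ConnectedComponent.sound (h x hx r hr)
  · intro e
    induction e using Sym2.ind with
    | _ x y => exact fun ⟨_, _, hxy⟩ => hTF hxy

theorem csmt_le_subCost [Fintype V] {G : SimpleGraph V} (σ : Sym2 V → ℕ) {R : Set V}
    {H : G.Subgraph} (hH : IsSteinerTree R H) : csmt G σ R ≤ subCost σ H :=
  Nat.sInf_le ⟨H, hH, rfl⟩

theorem subCost_le_sum [Fintype V] {G : SimpleGraph V} (σ : Sym2 V → ℕ) {H : G.Subgraph}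
    {F : Finset (Sym2 V)} (h : ∀ e ∈ H.edgeSet, e ∈ F) : subCost σ H ≤ ∑ e ∈ F, σ e :=
  Finset.sum_le_sum_of_subset fun e he => h e (by simpa using he)

theorem exists_isSMT [Fintype V] {G : SimpleGraph V} (hconn : G.Connected) (σ : Sym2 V → ℕ)
    {R : Set V} (hR : R.Nonempty) : ∃ H : G.Subgraph, IsSMT G σ R H := by
  have hG : G ≤ joinGraph G.edgeSet.toFinite.toFinset [] := fun a b hab => by
    simp [joinGraph, hab]
  obtain ⟨H, hH, -⟩ := exists_steinerTree (G := G) (F := G.edgeSet.toFinite.toFinset) hR (by simp)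
    fun x _ y _ => (hconn x y).mono hG
  have hmem : csmt G σ R ∈ {c | ∃ H : G.Subgraph, IsSteinerTree R H ∧ subCost σ H = c} :=
    Nat.sInf_mem ⟨_, H, hH, rfl⟩
  exact hmem

theorem exists_isTree_mstCost_eq [Fintype V] (w : Sym2 V → ℕ) {S : Set V} (hS : S.Nonempty) :
    ∃ T : SimpleGraph S, T.IsTree ∧
      mstCost w S = ∑ e ∈ T.edgeSet.toFinite.toFinset, w (e.map Subtype.val) := by
  have := hS.to_subtype
  obtain ⟨T, -, hT⟩ := (connected_top (V := S)).exists_isTree_le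
  exact Nat.sInf_mem (s := {c | ∃ T : SimpleGraph ↥S, T.IsTree ∧
    c = ∑ e ∈ T.edgeSet.toFinite.toFinset, w (e.map (Subtype.val : ↥S → V))}) ⟨_, T, hT, rfl⟩

/-- Replacing the edges at `u` by edges connecting the neighbours of `u` preserves
connections between the other vertices. -/
theorem links_of_star_replaced {G : SimpleGraph V} {H : G.Subgraph} {R : Set V}
    (hH : IsSteinerTree R H) {u : V} (hu : u ∉ R) {K : SimpleGraph V}
    (hHK : ∀ x y, H.Adj x y → x ≠ u → y ≠ u → K.Adj x y)
    (hN : Links K (H.neighborSet u)) : Links K R := by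
  intro x hx y hy
  have key : ∀ z : H.verts, (u = z.1 → ∀ v ∈ H.neighborSet u, K.Reachable x v) ∧
      (u ≠ z.1 → K.Reachable x z.1) := by
    intro z
    obtain ⟨p⟩ := hH.1.connected z ⟨x, hH.2 hx⟩
    generalize hx' : (⟨x, hH.2 hx⟩ : H.verts) = x' at p
    induction p with
    | nil => subst hx'; exact ⟨fun h => absurd (h ▸ hx) hu, fun _ => Reachable.refl _⟩
    | @cons z z' _ hzz' p ih =>
      have hadj : H.Adj z.1 z'.1 := hzz'
      obtain ⟨ih1, ih2⟩ := ih hx'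
      by_cases hz' : u = z'.1
      · have hzN : z.1 ∈ H.neighborSet u := by rw [hz']; exact hadj.symm
        exact ⟨fun h => absurd (h.symm.trans hz') hadj.ne, fun _ => ih1 hz' _ hzN⟩
      · refine ⟨fun hz v hv => ?_, fun hz => ?_⟩
        · have hzN : z'.1 ∈ H.neighborSet u := by rw [hz]; exact hadj
          exact (ih2 hz').trans (hN _ hzN v hv)
        · exact (ih2 hz').trans (hHK _ _ hadj (Ne.symm hz) (Ne.symm hz')).symm.reachable
  exact (key ⟨y, hH.2 hy⟩).2 fun h => hu (h ▸ hy)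

theorem sum_off_add_star_le [Fintype V] [DecidableEq V] {G : SimpleGraph V} (σ : Sym2 V → ℕ)
    (H : G.Subgraph) (u : V) :
    ∑ e ∈ H.edgeSet.toFinite.toFinset.filter (u ∉ ·), σ e +
      ∑ v ∈ (H.neighborSet u).toFinite.toFinset, σ s(u, v) ≤ subCost σ H := by
  have h : ∑ v ∈ (H.neighborSet u).toFinite.toFinset, σ s(u, v) ≤
      ∑ e ∈ H.edgeSet.toFinite.toFinset.filter (u ∈ ·), σ e := by
    rw [← Finset.sum_image (g := fun v => s(u, v)) fun v _ v' _ hv => Sym2.congr_right.1 hv]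
    refine Finset.sum_le_sum_of_subset fun e he => ?_
    obtain ⟨v, hv, rfl⟩ := Finset.mem_image.1 he
    simpa using hv
  have := Finset.sum_filter_add_sum_filter_not H.edgeSet.toFinite.toFinset (u ∈ ·) σ
  unfold subCost
  omega

/-- If for every set `A` of at least three neighbors of a
non-terminal `u` the total cost of the corresponding incident edges is at least
the cost of a minimum spanning tree of the bottleneck Steiner distance network
on `A`, then some SMT has `u` with degree at most 2. -/
theorem degree_k_nonterminal_reduction
    [Fintype V] (G : SimpleGraph V) (σ : Sym2 V → ℕ)
    (hconn : G.Connected) (hpos : ∀ e ∈ G.edgeSet, 0 < σ e)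
    (R : Set V) (hRne : R.Nonempty)
    (u : V) (hu : u ∉ R) (hdeg : 3 ≤ (G.neighborSet u).ncard)
    (hcond : ∀ A : Set V, A ⊆ G.neighborSet u → 3 ≤ A.ncard →
      mstCost (sym2Bottleneck G σ R) A ≤ ∑ v ∈ A.toFinite.toFinset, σ s(u, v)) :
    ∃ H : G.Subgraph, IsSMT G σ R H ∧ (H.neighborSet u).ncard ≤ 2 := by
  classical
  obtain ⟨T, hT, hTc⟩ := exists_isSMT hconn σ hRne
  by_cases hle : (T.neighborSet u).ncard ≤ 2
  · exact ⟨T, ⟨hT, hTc⟩, hle⟩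
  have hA := hcond (T.neighborSet u) (fun v hv => T.adj_sub hv) (by omega)
  obtain ⟨M, hM, hMc⟩ := exists_isTree_mstCost_eq (sym2Bottleneck G σ R)
    (Set.nonempty_of_ncard_ne_zero (s := T.neighborSet u) (by omega))
  let F := T.edgeSet.toFinite.toFinset.filter (u ∉ ·)
  let L := M.edgeSet.toFinite.toFinset.toList.map (Sym2.map Subtype.val)
  have hLu : ∀ e ∈ L, u ∉ e := by
    intro e he hue
    obtain ⟨f, -, rfl⟩ := List.mem_map.1 he
    obtain ⟨v, -, hv⟩ := Sym2.mem_map.1 hue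
    have hadj : T.Adj u v.1 := v.2
    exact hadj.ne hv.symm
  have hN : Links (joinGraph F L) (T.neighborSet u) := by
    intro x hx y hy
    let f : M →g joinGraph F L :=
      { toFun := Subtype.val
        map_rel' := fun {a b} hab => by
          refine (fromEdgeSet_adj _).2 ⟨Or.inr (List.mem_map.2 ⟨s(a, b), ?_, rfl⟩), ?_⟩
          · simpa using hab
          · exact fun h => hab.ne (Subtype.ext h) }
    exact (hM.connected ⟨x, hx⟩ ⟨y, hy⟩).map f
  have hlinks : Links (joinGraph F L) R := by
    refine links_of_star_replaced hT hu (fun x y hxy hx hy => ?_) hN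
    refine (fromEdgeSet_adj _).2 ⟨Or.inl ?_, hxy.ne⟩
    simp [F, hxy, hx.symm, hy.symm]
  obtain ⟨F', hF'G, hF'R, hF'c, hF'u⟩ := exists_linking hconn hpos hu L hLu F
    (fun e he => T.edgeSet_subset (by simp [F] at he; exact he.1)) (by simp [F]) hlinks
  have hLc : (L.map (sym2Bottleneck G σ R)).sum =
      mstCost (sym2Bottleneck G σ R) (T.neighborSet u) := by
    rw [hMc, List.map_map, ← Finset.sum_map_toList]
    rfl
  obtain ⟨H, hH, hHF⟩ := exists_steinerTree hRne hF'G hF'R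
  have h1 := csmt_le_subCost σ hH
  have h2 := subCost_le_sum σ hHF
  have h3 : ∑ e ∈ F, σ e + _ ≤ _ := sum_off_add_star_le σ T u
  refine ⟨H, ⟨hH, by omega⟩, le_trans (Set.ncard_le_ncard ?_) (hF'u.resolve_right (by omega))⟩
  exact fun v hv => hHF _ hv
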